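/- For every k ∈ ℕ there exists a constant c_k such that for all m, n ∈ ℕ, if A is an m×n (0,1)-matrix in which at least c_k·n entries equal 1 and whose rows are pairwise distinct, then A contains a member of each class of M(k). -/

import Mathlib

/-- The element `i ∈ [k]` viewed as an element of `[2k]` (the left half). -/
def finL (k : ℕ) (i : Fin k) : Fin (2 * k) := ⟨i.1, by have := i.isLt; omega⟩

/-- The element `π(i) + k` viewed as an element of `[2k]` (the right half). -/
def finR (k : ℕ) (i : Fin k) : Fin (2 * k) := ⟨k + i.1, by have := i.isLt; omega⟩

/-- The number of entries of the `(0,1)`-matrix `A` that equal 1. -/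
def onesCount {m n : ℕ} (A : Fin m → Fin n → Bool) : ℕ :=
  (Finset.univ.filter fun p : Fin m × Fin n => A p.1 p.2 = true).card

/-- `A` contains a member of each class of `M(k)`: for every permutation `σ` of `[k]` there
are pairwise distinct rows `r 1, …, r k` and columns `c 1 < … < c (2k)` such that
`A (r i) (c i) = 1` and `A (r i) (c (k + σ i)) = 1` for every `i ∈ [k]`. -/
def ContainsMk {m n : ℕ} (k : ℕ) (A : Fin m → Fin n → Bool) : Prop :=
  ∀ σ : Equiv.Perm (Fin k), ∃ r : Fin k → Fin m, ∃ c : Fin (2 * k) → Fin n,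
    Function.Injective r ∧ StrictMono c ∧
    ∀ i : Fin k, A (r i) (c (finL k i)) = true ∧ A (r i) (c (finR k (σ i))) = true

open Finset

/-- The set `S` of cells contains the pattern of the permutation `τ`. -/
def ContainsPerm {K : ℕ} (τ : Equiv.Perm (Fin K)) (S : Finset (ℕ × ℕ)) : Prop :=
  ∃ r c : Fin K → ℕ, StrictMono r ∧ StrictMono c ∧ ∀ i, (r i, c (τ i)) ∈ S

/-- The part of `S` in the block `b` of the partition of the grid into `t × t` blocks. -/
def blockPart (t : ℕ) (S : Finset (ℕ × ℕ)) (b : ℕ × ℕ) : Finset (ℕ × ℕ) :=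
  {p ∈ S | (p.1 / t, p.2 / t) = b}

theorem ContainsPerm.of_swap {K : ℕ} {τ : Equiv.Perm (Fin K)} {S : Finset (ℕ × ℕ)}
    (h : ContainsPerm τ.symm (S.image Prod.swap)) : ContainsPerm τ S := by
  obtain ⟨r, c, hr, hc, h⟩ := h
  refine ⟨c, r, hc, hr, fun i => ?_⟩
  have := h (τ i)
  simpa using this

theorem ContainsPerm.of_image_div {K t : ℕ} {τ : Equiv.Perm (Fin K)} {S : Finset (ℕ × ℕ)}
    (h : ContainsPerm τ (S.image fun p => (p.1 / t, p.2 / t))) : ContainsPerm τ S := by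
  obtain ⟨r, c, hr, hc, h⟩ := h
  simp only [mem_image] at h
  choose p hpS hp using h
  simp only [Prod.mk.injEq] at hp
  refine ⟨fun i => (p i).1, fun j => (p (τ.symm j)).2, fun i j hij => ?_, fun i j hij => ?_,
    fun i => by simpa using hpS i⟩
  · by_contra hlt
    have := Nat.div_le_div_right (c := t) (not_lt.mp hlt)
    rw [(hp i).1, (hp j).1] at this
    exact absurd (hr hij) (not_lt.mpr this)
  · by_contra hlt
    have := Nat.div_le_div_right (c := t) (not_lt.mp hlt)
    rw [(hp _).2, (hp _).2, τ.apply_symm_apply, τ.apply_symm_apply] at this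
    exact absurd (hc hij) (not_lt.mpr this)

/-- If `K` blocks in one column of blocks have the same set of at least `K` nonempty columns,
then all permutation patterns of size `K` occur. -/
theorem containsPerm_of_common_columns {K t J : ℕ} (τ : Equiv.Perm (Fin K))
    {S : Finset (ℕ × ℕ)} {U T : Finset ℕ} (hU : K ≤ #U) (hT : K ≤ #T)
    (h : ∀ I ∈ U, (blockPart t S (I, J)).image Prod.snd = T) : ContainsPerm τ S := by
  let u := U.orderEmbOfCardLe hU
  let c := T.orderEmbOfCardLe hT
  have hu : ∀ i, u i ∈ U := U.orderEmbOfCardLe_mem hU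
  have hc : ∀ i, c i ∈ T := T.orderEmbOfCardLe_mem hT
  have key : ∀ i, ∃ x, (x, c (τ i)) ∈ S ∧ x / t = u i := by
    intro i
    have := hc (τ i)
    rw [← h _ (hu i)] at this
    simp only [blockPart, mem_image, mem_filter, Prod.mk.injEq] at this
    obtain ⟨p, ⟨hpS, hp1, -⟩, hp2⟩ := this
    exact ⟨p.1, by rw [← hp2]; exact hpS, hp1⟩
  choose x hxS hx using key
  refine ⟨x, c, fun i j hij => ?_, c.strictMono, hxS⟩
  by_contra hlt
  have := Nat.div_le_div_right (c := t) (not_lt.mp hlt)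
  rw [hx, hx] at this
  exact absurd (u.strictMono hij) (not_lt.mpr this)

theorem mem_Ico_of_div_eq {t x I : ℕ} (ht : 0 < t) (h : x / t = I) :
    x ∈ Ico (t * I) (t * I + t) := by
  subst h
  rw [mem_Ico]
  exact ⟨Nat.mul_div_le x t, by have := Nat.lt_mul_div_succ x ht; rwa [mul_add, mul_one] at this⟩

/-- A pattern-avoiding set has few blocks with at least `K` nonempty columns. -/
theorem card_wide_blocks_le {K t N : ℕ} (ht : 0 < t) {τ : Equiv.Perm (Fin K)}
    {S : Finset (ℕ × ℕ)} (hS : ¬ ContainsPerm τ S) {B : Finset (ℕ × ℕ)}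
    (hB : ∀ b ∈ B, b.2 < N) (hwide : ∀ b ∈ B, K ≤ #((blockPart t S b).image Prod.snd)) :
    #B ≤ 2 ^ t * K * N := by
  have := card_le_mul_card_image_of_maps_to (s := B) (f := Prod.snd) (t := range N)
    (fun b hb => mem_range.mpr (hB b hb)) (2 ^ t * K) ?_
  · simpa using this
  intro J _
  by_contra! hlt
  have hpow : #(Ico (t * J) (t * J + t)).powerset = 2 ^ t := by simp
  rw [← hpow] at hlt
  obtain ⟨T, -, hT⟩ := exists_lt_card_fiber_of_mul_lt_card_of_maps_to
    (f := fun b => (blockPart t S b).image Prod.snd) (fun b hb => by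
      rw [mem_filter] at hb
      rw [mem_powerset]
      intro y hy
      simp only [blockPart, mem_image, mem_filter] at hy
      obtain ⟨p, ⟨-, hp⟩, rfl⟩ := hy
      exact mem_Ico_of_div_eq ht (by rw [← hb.2, ← hp])) hlt
  have hmem : ∀ b ∈ {b ∈ {b ∈ B | b.2 = J} | (blockPart t S b).image Prod.snd = T},
      b ∈ B ∧ b.2 = J ∧ (blockPart t S b).image Prod.snd = T := by
    intro b hb
    simp only [mem_filter] at hb
    exact ⟨hb.1.1, hb.1.2, hb.2⟩
  obtain ⟨b, hb⟩ := card_pos.mp (by omega : 0 < #{b ∈ {b ∈ B | b.2 = J} |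
    (blockPart t S b).image Prod.snd = T})
  refine hS (containsPerm_of_common_columns (t := t) (J := J) (T := T)
    (U := {b ∈ {b ∈ B | b.2 = J} | (blockPart t S b).image Prod.snd = T}.image Prod.fst)
    τ ?_ ?_ ?_)
  · rw [card_image_of_injOn]
    · exact hT.le
    · intro b hb b' hb' hbb
      exact Prod.ext hbb ((hmem b hb).2.1.trans (hmem b' hb').2.1.symm)
  · rw [← (hmem b hb).2.2]
    exact hwide b (hmem b hb).1
  · intro I hI
    obtain ⟨b', hb', rfl⟩ := mem_image.mp hI
    have := hmem b' hb'
    rw [← this.2.1]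
    exact this.2.2

theorem image_fst_blockPart_swap (t : ℕ) (S : Finset (ℕ × ℕ)) (b : ℕ × ℕ) :
    (blockPart t (S.image Prod.swap) b.swap).image Prod.snd =
      (blockPart t S b).image Prod.fst := by
  ext x
  simp only [blockPart, mem_image, mem_filter, Prod.exists]
  constructor
  · rintro ⟨y, x', ⟨⟨a, b', hab, h1⟩, h2⟩, h3⟩
    simp_all [Prod.ext_iff]
    grind
  · rintro ⟨x', y, ⟨h1, h2⟩, h3⟩
    simp_all [Prod.ext_iff]
    grind

/-- A pattern-avoiding set has few blocks with at least `K` nonempty rows. -/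
theorem card_tall_blocks_le {K t N : ℕ} (ht : 0 < t) {τ : Equiv.Perm (Fin K)}
    {S : Finset (ℕ × ℕ)} (hS : ¬ ContainsPerm τ S) {B : Finset (ℕ × ℕ)}
    (hB : ∀ b ∈ B, b.1 < N) (htall : ∀ b ∈ B, K ≤ #((blockPart t S b).image Prod.fst)) :
    #B ≤ 2 ^ t * K * N := by
  rw [← card_image_of_injective B Prod.swap_injective]
  refine card_wide_blocks_le (t := t) ht (fun h => hS h.of_swap) ?_ ?_
  · intro b hb
    obtain ⟨b, hb', rfl⟩ := mem_image.mp hb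
    exact hB b hb'
  · intro b hb
    obtain ⟨b, hb', rfl⟩ := mem_image.mp hb
    rw [image_fst_blockPart_swap]
    exact htall b hb'

theorem card_blockPart_le_image (t : ℕ) (S : Finset (ℕ × ℕ)) (b : ℕ × ℕ) :
    #(blockPart t S b) ≤
      #((blockPart t S b).image Prod.fst) * #((blockPart t S b).image Prod.snd) := by
  rw [← card_product]
  exact card_le_card fun p hp =>
    mem_product.mpr ⟨mem_image_of_mem _ hp, mem_image_of_mem _ hp⟩

theorem card_blockPart_le {t : ℕ} (ht : 0 < t) (S : Finset (ℕ × ℕ)) (b : ℕ × ℕ) :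
    #(blockPart t S b) ≤ t * t := by
  have : blockPart t S b ⊆ Ico (t * b.1) (t * b.1 + t) ×ˢ Ico (t * b.2) (t * b.2 + t) := by
    intro p hp
    obtain ⟨-, hp⟩ := mem_filter.mp hp
    exact mem_product.mpr ⟨mem_Ico_of_div_eq ht (by rw [← hp]), mem_Ico_of_div_eq ht (by rw [← hp])⟩
  simpa using card_le_card this

/-- The recursive inequality of Marcus and Tardos. -/
theorem card_le_of_avoids {K t N : ℕ} (ht : 0 < t) {τ : Equiv.Perm (Fin K)}
    {S : Finset (ℕ × ℕ)} (hS : ¬ ContainsPerm τ S)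
    (hN : ∀ p ∈ S, p.1 / t < N ∧ p.2 / t < N) :
    #S ≤ K * K * #(S.image fun p => (p.1 / t, p.2 / t)) + 2 * (t * t * (2 ^ t * K * N)) := by
  set f : ℕ × ℕ → ℕ × ℕ := fun p => (p.1 / t, p.2 / t) with hf
  set B := S.image f with hBdef
  have hBN : ∀ b ∈ B, b.1 < N ∧ b.2 < N := by
    intro b hb
    obtain ⟨p, hp, rfl⟩ := mem_image.mp hb
    exact hN p hp
  set Wd := {b ∈ B | K ≤ #((blockPart t S b).image Prod.snd)} with hWd
  set Tl := {b ∈ B | K ≤ #((blockPart t S b).image Prod.fst)} with hTl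
  set Rs := {b ∈ B | #((blockPart t S b).image Prod.fst) ≤ K ∧
    #((blockPart t S b).image Prod.snd) ≤ K} with hRs
  have hWc : #Wd ≤ 2 ^ t * K * N := card_wide_blocks_le ht hS
    (fun b hb => (hBN b (mem_filter.mp hb).1).2) (fun b hb => (mem_filter.mp hb).2)
  have hTc : #Tl ≤ 2 ^ t * K * N := card_tall_blocks_le ht hS
    (fun b hb => (hBN b (mem_filter.mp hb).1).1) (fun b hb => (mem_filter.mp hb).2)
  have hcover : S ⊆ Rs.biUnion (blockPart t S) ∪
      (Wd.biUnion (blockPart t S) ∪ Tl.biUnion (blockPart t S)) := by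
    intro p hp
    have hpB : f p ∈ B := mem_image_of_mem f hp
    have hpp : p ∈ blockPart t S (f p) := mem_filter.mpr ⟨hp, rfl⟩
    simp only [mem_union, mem_biUnion]
    rcases le_total K #((blockPart t S (f p)).image Prod.snd) with h | h
    · exact Or.inr (Or.inl ⟨_, mem_filter.mpr ⟨hpB, h⟩, hpp⟩)
    rcases le_total K #((blockPart t S (f p)).image Prod.fst) with h' | h'
    · exact Or.inr (Or.inr ⟨_, mem_filter.mpr ⟨hpB, h'⟩, hpp⟩)
    · exact Or.inl ⟨_, mem_filter.mpr ⟨hpB, h', h⟩, hpp⟩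
  have h1 : #(Rs.biUnion (blockPart t S)) ≤ #Rs * (K * K) :=
    card_biUnion_le_card_mul _ _ _ fun b hb => (card_blockPart_le_image t S b).trans
      (Nat.mul_le_mul (mem_filter.mp hb).2.1 (mem_filter.mp hb).2.2)
  have h2 : #(Wd.biUnion (blockPart t S)) ≤ #Wd * (t * t) :=
    card_biUnion_le_card_mul _ _ _ fun b _ => card_blockPart_le ht S b
  have h3 : #(Tl.biUnion (blockPart t S)) ≤ #Tl * (t * t) :=
    card_biUnion_le_card_mul _ _ _ fun b _ => card_blockPart_le ht S b
  have h4 : #Rs ≤ #B := card_filter_le _ _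
  calc #S ≤ _ := card_le_card hcover
    _ ≤ _ := (card_union_le _ _).trans (Nat.add_le_add_left (card_union_le _ _) _)
    _ ≤ #B * (K * K) + (2 ^ t * K * N * (t * t) + 2 ^ t * K * N * (t * t)) := by
      gcongr
      · exact h1.trans (by gcongr)
      · exact h2.trans (by gcongr)
      · exact h3.trans (by gcongr)
    _ = _ := by ring

/-- The Marcus–Tardos theorem (Füredi–Hajnal conjecture). -/
theorem marcus_tardos (K : ℕ) : ∃ C : ℕ, ∀ (τ : Equiv.Perm (Fin K)) (n : ℕ)
    (S : Finset (ℕ × ℕ)), S ⊆ range n ×ˢ range n → ¬ ContainsPerm τ S → #S ≤ C * n := by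
  set t := 4 * (K * K) + 4 with ht
  set L := 2 * (t * t * (2 ^ t * K)) with hL
  refine ⟨L + t, fun τ n => ?_⟩
  induction n using Nat.strong_induction_on with
  | _ n ih =>
    intro S hSn hS
    rcases lt_or_ge n t with hnt | hnt
    · calc #S ≤ n * n := by simpa using card_le_card hSn
        _ ≤ (L + t) * n := Nat.mul_le_mul_right _ (by omega)
    have hdiv : ∀ p ∈ S, p.1 / t < n / t + 1 ∧ p.2 / t < n / t + 1 := by
      intro p hp
      have := mem_product.mp (hSn hp)
      simp only [mem_range] at this
      exact ⟨Nat.lt_succ_of_le (Nat.div_le_div_right this.1.le),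
        Nat.lt_succ_of_le (Nat.div_le_div_right this.2.le)⟩
    have hmul : t * (n / t) ≤ n := Nat.mul_div_le n t
    set N := n / t + 1 with hN
    have htN : t * N ≤ 2 * n := by rw [hN, mul_add]; omega
    have h4N : 4 * N ≤ t * N := Nat.mul_le_mul_right _ (by omega)
    have hrec := card_le_of_avoids (by omega : 0 < t) hS hdiv
    have hih := ih N (by omega) (S.image fun p => (p.1 / t, p.2 / t)) (by
      intro b hb
      obtain ⟨p, hp, rfl⟩ := mem_image.mp hb
      simpa using hdiv p hp) (fun h => hS h.of_image_div)
    have hK : 2 * (K * K * N) ≤ n := by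
      have : t * N = 4 * (K * K * N) + 4 * N := by rw [ht]; ring
      omega
    have e1 : #S ≤ K * K * ((L + t) * N) + L * N := by
      calc #S ≤ _ := hrec
        _ ≤ K * K * ((L + t) * N) + 2 * (t * t * (2 ^ t * K * N)) := by gcongr
        _ = _ := by rw [hL]; ring
    have e2 : 2 * (K * K * ((L + t) * N)) ≤ (L + t) * n := by
      calc _ = (L + t) * (2 * (K * K * N)) := by ring
        _ ≤ _ := Nat.mul_le_mul_left _ hK
    have e3 : 2 * (L * N) ≤ (L + t) * n := by
      calc _ = L * (2 * N) := by ring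
        _ ≤ _ := Nat.mul_le_mul (by omega) (by omega)
    omega

theorem marcus_tardos_on (K : ℕ) : ∃ C : ℕ, ∀ (τ : Equiv.Perm (Fin K)) (W : Finset ℕ)
    (S : Finset (ℕ × ℕ)), S ⊆ W ×ˢ W → ¬ ContainsPerm τ S → #S ≤ C * #W := by
  obtain ⟨C, hC⟩ := marcus_tardos K
  refine ⟨C, fun τ W S hSW hS => ?_⟩
  let e : ℕ → ℕ := fun x => #{y ∈ W | y < x}
  have hmono : Monotone e := fun a b hab => card_le_card fun y hy => by
    rw [mem_filter] at hy ⊢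
    exact ⟨hy.1, hy.2.trans_le hab⟩
  have hstrict : ∀ a ∈ W, ∀ b, a < b → e a < e b := fun a ha b hab =>
    card_lt_card (ssubset_iff_of_subset (fun y hy => by
      rw [mem_filter] at hy ⊢
      exact ⟨hy.1, hy.2.trans hab⟩) |>.mpr ⟨a, by simp [ha, hab], by simp⟩)
  have hlt : ∀ a ∈ W, e a < #W := fun a ha =>
    card_lt_card (ssubset_iff_of_subset (filter_subset _ _) |>.mpr ⟨a, ha, by simp⟩)
  have hinj : ∀ a ∈ W, ∀ b ∈ W, e a = e b → a = b := by
    intro a ha b hb hab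
    rcases lt_trichotomy a b with h | h | h
    · exact absurd hab (hstrict a ha b h).ne
    · exact h
    · exact absurd hab (hstrict b hb a h).ne'
  rw [← card_image_of_injOn (f := Prod.map e e) (s := S)]
  · refine hC τ _ _ ?_ ?_
    · intro q hq
      obtain ⟨p, hp, rfl⟩ := mem_image.mp hq
      have := mem_product.mp (hSW hp)
      simpa using ⟨hlt _ this.1, hlt _ this.2⟩
    · rintro ⟨r, c, hr, hc, h⟩
      simp only [mem_image] at h
      choose p hpS hp using h
      simp only [Prod.map, Prod.mk.injEq] at hp
      refine hS ⟨fun i => (p i).1, fun j => (p (τ.symm j)).2, fun i j hij => ?_,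
        fun i j hij => ?_, fun i => by simpa using hpS i⟩
      · refine hmono.reflect_lt ?_
        rw [(hp i).1, (hp j).1]
        exact hr hij
      · refine hmono.reflect_lt ?_
        rw [(hp _).2, (hp _).2, τ.apply_symm_apply, τ.apply_symm_apply]
        exact hc hij
  · intro p hp q hq hpq
    have h1 := mem_product.mp (hSW hp)
    have h2 := mem_product.mp (hSW hq)
    simp only [Prod.map, Prod.mk.injEq] at hpq
    exact Prod.ext (hinj _ h1.1 _ h2.1 hpq.1) (hinj _ h1.2 _ h2.2 hpq.2)

/-- An ordered graph with linearly many edges contains every ordered matching whose left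
endpoints all precede its right endpoints. -/
theorem exists_ordered_matching (K : ℕ) : ∃ C : ℕ, ∀ (τ : Equiv.Perm (Fin K)) (W : Finset ℕ)
    (G : Finset (ℕ × ℕ)), G ⊆ W ×ˢ W → (∀ p ∈ G, p.1 < p.2) → C * #W < #G →
    ∃ r c : Fin K → ℕ, StrictMono r ∧ StrictMono c ∧ (∀ i j, r i < c j) ∧
      ∀ i, (r i, c (τ i)) ∈ G := by
  obtain ⟨C, hC⟩ := marcus_tardos_on (K + 1)
  refine ⟨C, fun τ W G hGW hG hcard => ?_⟩
  let τ' : Equiv.Perm (Fin (K + 1)) :=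
    (finRotate (K + 1)).trans (Equiv.Perm.decomposeFin.symm (0, τ))
  have hlast : τ' (Fin.last K) = 0 := by simp [τ']
  have hcast : ∀ i : Fin K, τ' i.castSucc = (τ i).succ := by
    intro i
    simp [τ']
  have : ContainsPerm τ' G := by
    by_contra h
    exact absurd hcard (not_lt.mpr (hC τ' W G hGW h))
  obtain ⟨r, c, hr, hc, h⟩ := this
  have hmid : r (Fin.last K) < c 0 := by
    have := hG _ (h (Fin.last K))
    rwa [hlast] at this
  refine ⟨fun i => r i.castSucc, fun j => c j.succ, fun i j hij => hr (by simpa using hij),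
    fun i j hij => hc (by simpa using hij), fun i j => ?_, fun i => ?_⟩
  · exact (hr (Fin.castSucc_lt_last i)).trans (hmid.trans (hc (Fin.succ_pos j)))
  · simpa only [hcast] using h i.castSucc

/-- Distinct members `w i` of `F` realise the two-sided pattern of `σ`. -/
def FamilyContains {k : ℕ} (σ : Equiv.Perm (Fin k)) (F : Finset (Finset ℕ)) : Prop :=
  ∃ (w : Fin k → Finset ℕ) (l r : Fin k → ℕ), Function.Injective w ∧ (∀ i, w i ∈ F) ∧
    StrictMono l ∧ StrictMono r ∧ (∀ i j, l i < r j) ∧ ∀ i, l i ∈ w i ∧ r (σ i) ∈ w i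

/-- A family of small sets in which many pairs are covered contains every two-sided pattern. -/
theorem exists_card_covered_pairs_le (k s : ℕ) : ∃ C : ℕ, ∀ (σ : Equiv.Perm (Fin k))
    (W : Finset ℕ) (F : Finset (Finset ℕ)), (∀ T ∈ F, #T ≤ s) → ¬ FamilyContains σ F →
    #{p ∈ W ×ˢ W | p.1 < p.2 ∧ ∃ T ∈ F, p.1 ∈ T ∧ p.2 ∈ T} ≤ C * #W := by
  obtain ⟨C, hC⟩ := exists_ordered_matching (k * (s * k))
  refine ⟨C, fun σ W F hs hF => ?_⟩
  by_contra! hcard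
  have hspos : 0 < s := by
    obtain ⟨p, hp⟩ := card_pos.mp (Nat.zero_lt_of_lt hcard)
    obtain ⟨-, T, hT, hpT, -⟩ := (mem_filter.mp hp).2
    exact (card_pos.mpr ⟨_, hpT⟩).trans_le (hs T hT)
  let φ : Fin k × Fin (s * k) ≃ Fin (k * (s * k)) := finProdFinEquiv
  let τ : Equiv.Perm (Fin (k * (s * k))) :=
    φ.symm.trans ((Equiv.prodCongr σ (Equiv.refl _)).trans φ)
  have hφ : ∀ i i' : Fin k, ∀ j j', i < i' → φ (i, j) < φ (i', j') := by
    intro i i' j j' hii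
    change (j : ℕ) + s * k * i < (j' : ℕ) + s * k * i'
    have h1 : s * k * (i + 1) ≤ s * k * i' := Nat.mul_le_mul_left _ hii
    have := j.isLt
    rw [mul_add, mul_one] at h1
    omega
  obtain ⟨r, c, hr, hc, hrc, h⟩ := hC τ W _ (filter_subset _ _)
    (fun p hp => (mem_filter.mp hp).2.1) hcard
  have key : ∀ i j, ∃ T ∈ F, r (φ (i, j)) ∈ T ∧ c (φ (σ i, j)) ∈ T := by
    intro i j
    have := (mem_filter.mp (h (φ (i, j)))).2.2
    simpa [τ] using this
  choose w hwF hwr hwc using key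
  obtain ⟨f, hfinj, hf⟩ := (all_card_le_biUnion_card_iff_exists_injective
    (fun i => univ.image (w i))).mp (by
      intro A
      rcases A.eq_empty_or_nonempty with rfl | ⟨i, hi⟩
      · simp
      have hle : s * k ≤ s * #(univ.image (w i)) := by
        have := card_le_mul_card_image (f := w i) (univ : Finset (Fin (s * k))) s ?_
        · simpa using this
        intro T hT
        obtain ⟨j, -, rfl⟩ := mem_image.mp hT
        refine le_trans ?_ (hs _ (hwF i j))
        refine card_le_card_of_injOn (fun j' => r (φ (i, j'))) ?_ ?_
        · intro j' hj'
          have := (mem_filter.mp hj').2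
          rw [← this]
          exact hwr i j'
        · intro a _ b _ hab
          simpa using φ.injective (hr.injective hab)
      calc #A ≤ k := by simpa using card_le_univ A
        _ ≤ _ := Nat.le_of_mul_le_mul_left hle hspos
        _ ≤ _ := card_le_card (subset_biUnion_of_mem (fun i => univ.image (w i)) hi))
  have hf' : ∀ i, ∃ j, w i j = f i := fun i => by simpa using hf i
  choose g hg using hf'
  refine hF ⟨f, fun i => r (φ (i, g i)), fun i => c (φ (i, g (σ.symm i))), hfinj,
    fun i => hg i ▸ hwF i _, fun i i' hii => hr (hφ _ _ _ _ hii),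
    fun i i' hii => hc (hφ _ _ _ _ hii), fun i j => hrc _ _, fun i => ⟨hg i ▸ hwr i _, ?_⟩⟩
  simpa only [σ.symm_apply_apply, hg] using hwc i (g i)

/-- A pattern-free family of small nonempty sets has linear size. -/
theorem exists_card_family_le (k s : ℕ) : ∃ D : ℕ, ∀ (σ : Equiv.Perm (Fin k))
    (W : Finset ℕ) (F : Finset (Finset ℕ)), (∀ T ∈ F, #T ≤ s) → (∀ T ∈ F, T.Nonempty) →
    (∀ T ∈ F, T ⊆ W) → ¬ FamilyContains σ F → #F ≤ D * #W := by
  obtain ⟨C, hC⟩ := exists_card_covered_pairs_le k s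
  refine ⟨2 ^ (2 * C + 1), fun σ W => ?_⟩
  induction hw : #W generalizing W with
  | zero =>
    intro F _ hne hW _
    rw [card_eq_zero] at hw
    subst hw
    rw [mul_zero, Nat.le_zero, card_eq_zero, eq_empty_iff_forall_notMem]
    intro T hT
    exact (hne T hT).ne_empty (subset_empty.mp (hW T hT))
  | succ n ih =>
    intro F hs hne hW hF
    set G := {p ∈ W ×ˢ W | p.1 < p.2 ∧ ∃ T ∈ F, p.1 ∈ T ∧ p.2 ∈ T} with hG
    set P := {p ∈ W ×ˢ W | ∃ T ∈ F, p.1 ∈ T ∧ p.2 ∈ T} with hP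
    have hGc : #G ≤ C * #W := hC σ W F hs hF
    have hPG : P ⊆ (G ∪ G.image Prod.swap) ∪ W.image fun x => (x, x) := by
      rintro ⟨a, b⟩ hp
      simp only [hP, hG, mem_filter, mem_product, mem_union, mem_image, Prod.exists,
        Prod.swap_prod_mk, Prod.mk.injEq] at hp ⊢
      obtain ⟨⟨ha, hb⟩, T, hT, haT, hbT⟩ := hp
      rcases lt_trichotomy a b with h | h | h
      · exact Or.inl (Or.inl ⟨⟨ha, hb⟩, h, T, hT, haT, hbT⟩)
      · exact Or.inr ⟨a, ha, rfl, h⟩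
      · exact Or.inl (Or.inr ⟨b, a, ⟨⟨hb, ha⟩, h, T, hT, hbT, haT⟩, rfl, rfl⟩)
    have hPc : #P ≤ #W * (2 * C + 1) := by
      have h1 := card_le_card hPG
      have h2 := card_union_le (G ∪ G.image Prod.swap) (W.image fun x => (x, x))
      have h3 := card_union_le G (G.image Prod.swap)
      have h4 : #(G.image Prod.swap) ≤ #G := card_image_le
      have h5 : #(W.image fun x => (x, x)) ≤ #W := card_image_le
      have h6 : #W * (2 * C + 1) = 2 * (C * #W) + #W := by ring
      omega
    obtain ⟨v, hv, hdeg⟩ := exists_card_fiber_le_of_card_le_mul (f := Prod.fst)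
      (card_pos.mp (by omega : 0 < #W)) hPc
    set Nv := {p ∈ P | p.1 = v}.image Prod.snd with hNv
    have hstar : #{T ∈ F | v ∈ T} ≤ 2 ^ (2 * C + 1) := by
      calc #{T ∈ F | v ∈ T} ≤ #Nv.powerset := by
            refine card_le_card fun T hT => ?_
            obtain ⟨hT, hvT⟩ := mem_filter.mp hT
            rw [mem_powerset]
            intro x hx
            refine mem_image.mpr ⟨(v, x), mem_filter.mpr ⟨mem_filter.mpr
              ⟨mem_product.mpr ⟨hv, hW T hT hx⟩, T, hT, hvT, hx⟩, rfl⟩, rfl⟩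
        _ = 2 ^ #Nv := card_powerset _
        _ ≤ _ := Nat.pow_le_pow_right (by norm_num) (card_image_le.trans hdeg)
    have hrest : #{T ∈ F | v ∉ T} ≤ 2 ^ (2 * C + 1) * n := by
      refine ih (W.erase v) (by rw [card_erase_of_mem hv]; omega) _
        (fun T hT => hs T (mem_filter.mp hT).1) (fun T hT => hne T (mem_filter.mp hT).1)
        (fun T hT => ?_) ?_
      · obtain ⟨hT, hvT⟩ := mem_filter.mp hT
        exact subset_erase.mpr ⟨hW T hT, hvT⟩
      · rintro ⟨w, l, r, h1, h2, h3⟩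
        exact hF ⟨w, l, r, h1, fun i => (mem_filter.mp (h2 i)).1, h3⟩
    rw [← card_filter_add_card_filter_not (s := F) (fun T => v ∈ T)]
    rw [mul_add, mul_one]
    omega

/-- Consecutive chunks of size `s` of a finite set of numbers. -/
theorem exists_chunks (s : ℕ) (E : Finset ℕ) : ∃ ch : ℕ → Finset ℕ,
    (∀ q < #E / s, ch q ⊆ E ∧ #(ch q) = s) ∧
    ∀ q q', q < q' → q' < #E / s → ∀ x ∈ ch q, ∀ y ∈ ch q', x < y := by
  have hcard : ∀ hf : {x | x ∈ E}.Finite, #hf.toFinset = #E := fun hf => by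
    congr 1
    ext x
    simp
  have hfin : {x | x ∈ E}.Finite := E.finite_toSet
  have hmono : StrictMonoOn (Nat.nth (· ∈ E)) (Set.Iio #E) := by
    have := Nat.nth_strictMonoOn hfin
    rwa [hcard] at this
  have hidx : ∀ q < #E / s, ∀ i < s, q * s + i < #E := by
    intro q hq i hi
    have h1 : (q + 1) * s ≤ #E / s * s := Nat.mul_le_mul_right _ hq
    have h2 := Nat.div_mul_le_self #E s
    rw [add_mul, one_mul] at h1
    omega
  refine ⟨fun q => (range s).image fun i => Nat.nth (· ∈ E) (q * s + i), fun q hq => ⟨?_, ?_⟩, ?_⟩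
  · intro x hx
    obtain ⟨i, hi, rfl⟩ := mem_image.mp hx
    exact Nat.nth_mem_of_lt_card hfin (by
      rw [hcard]
      exact hidx q hq i (mem_range.mp hi))
  · rw [card_image_of_injOn, card_range]
    intro i hi j hj hij
    have := hmono.injOn (hidx q hq i (mem_range.mp hi)) (hidx q hq j (mem_range.mp hj)) hij
    omega
  · intro q q' hqq hq' x hx y hy
    obtain ⟨i, hi, rfl⟩ := mem_image.mp hx
    obtain ⟨j, hj, rfl⟩ := mem_image.mp hy
    rw [mem_range] at hi hj
    refine hmono (hidx q (hqq.trans hq') i hi) (hidx q' hq' j hj) ?_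
    have h1 : (q + 1) * s ≤ q' * s := Nat.mul_le_mul_right _ hqq
    rw [add_mul, one_mul] at h1
    omega

/-- The support of a row of a `(0,1)`-matrix, as a set of numbers. -/
def rowSupport {m n : ℕ} (A : Fin m → Fin n → Bool) (a : Fin m) : Finset ℕ :=
  ({j | A a j = true} : Finset (Fin n)).map Fin.valEmbedding

theorem mem_rowSupport {m n : ℕ} {A : Fin m → Fin n → Bool} {a : Fin m} {x : ℕ} :
    x ∈ rowSupport A a ↔ ∃ h : x < n, A a ⟨x, h⟩ = true := by
  simp only [rowSupport, mem_map, mem_filter, mem_univ, true_and, Fin.valEmbedding_apply]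
  constructor
  · rintro ⟨j, hj, rfl⟩
    exact ⟨j.isLt, hj⟩
  · rintro ⟨h, hx⟩
    exact ⟨⟨x, h⟩, hx, rfl⟩

theorem rowSupport_injective {m n : ℕ} {A : Fin m → Fin n → Bool} (hA : Function.Injective A) :
    Function.Injective (rowSupport A) := by
  intro a b hab
  refine hA (funext fun j => Bool.eq_iff_iff.mpr ?_)
  have := congrArg (fun T => (j : ℕ) ∈ T) hab
  simpa [mem_rowSupport] using this

theorem onesCount_eq_sum {m n : ℕ} (A : Fin m → Fin n → Bool) :
    onesCount A = ∑ a, #(rowSupport A a) := by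
  simp only [onesCount, rowSupport, card_map, card_filter]
  exact Fintype.sum_prod_type _

/-- The condition of `ContainsMk` for a single permutation. -/
def ContainsMkPerm {m n k : ℕ} (σ : Equiv.Perm (Fin k)) (A : Fin m → Fin n → Bool) : Prop :=
  ∃ r : Fin k → Fin m, ∃ c : Fin (2 * k) → Fin n, Function.Injective r ∧ StrictMono c ∧
    ∀ i : Fin k, A (r i) (c (finL k i)) = true ∧ A (r i) (c (finR k (σ i))) = true

theorem containsMkPerm_of_subset {m n k : ℕ} (σ : Equiv.Perm (Fin k)) {A : Fin m → Fin n → Bool}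
    {R : Finset (Fin m)} {T : Finset ℕ} (hR : k ≤ #R) (hT : #T = 2 * k)
    (h : ∀ a ∈ R, T ⊆ rowSupport A a) : ContainsMkPerm σ A := by
  rcases Nat.eq_zero_or_pos k with rfl | hk
  · exact ⟨fun i => i.elim0, fun i => i.elim0, fun i => i.elim0, fun i => i.elim0,
      fun i => i.elim0⟩
  obtain ⟨a, ha⟩ := card_pos.mp (hk.trans_le hR)
  let e := T.orderEmbOfFin hT
  let u := R.orderEmbOfCardLe hR
  have he : ∀ x, e x ∈ T := T.orderEmbOfFin_mem hT
  have hu : ∀ i, u i ∈ R := R.orderEmbOfCardLe_mem hR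
  refine ⟨u, fun x => ⟨e x, (mem_rowSupport.mp (h a ha (he x))).1⟩, u.injective,
    fun x y hxy => e.strictMono hxy, fun i => ⟨?_, ?_⟩⟩
  · exact (mem_rowSupport.mp (h _ (hu i) (he _))).2
  · exact (mem_rowSupport.mp (h _ (hu i) (he _))).2

theorem containsMkPerm_of_halves {m n k : ℕ} (σ : Equiv.Perm (Fin k)) {A : Fin m → Fin n → Bool}
    {a : Fin k → Fin m} {l r : Fin k → ℕ} (ha : Function.Injective a) (hl : StrictMono l)
    (hr : StrictMono r) (hlr : ∀ i j, l i < r j) (hal : ∀ i, l i ∈ rowSupport A (a i))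
    (har : ∀ i, r (σ i) ∈ rowSupport A (a i)) : ContainsMkPerm σ A := by
  have hr' : ∀ j, r j < n := fun j => by
    obtain ⟨h, -⟩ := mem_rowSupport.mp (har (σ.symm j))
    rwa [σ.apply_symm_apply] at h
  let c : Fin (2 * k) → Fin n := fun x =>
    if h : (x : ℕ) < k then ⟨l ⟨x, h⟩, (mem_rowSupport.mp (hal ⟨x, h⟩)).1⟩
    else ⟨r ⟨x - k, by omega⟩, hr' _⟩
  refine ⟨a, c, ha, fun x y hxy => ?_, fun i => ⟨?_, ?_⟩⟩
  · have hxy' : (x : ℕ) < y := hxy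
    by_cases hx : (x : ℕ) < k <;> by_cases hy : (y : ℕ) < k
    · simpa [c, hx, hy] using hl hxy'
    · simpa [c, hx, hy] using hlr _ _
    · omega
    · simp only [c, hx, hy, dite_false, Fin.mk_lt_mk]
      exact hr (by rw [Fin.mk_lt_mk]; omega)
  · simpa [c, finL] using (mem_rowSupport.mp (hal i)).2
  · simpa [c, finR] using (mem_rowSupport.mp (har i)).2

theorem exists_onesCount_le {k : ℕ} (hk : 0 < k) : ∃ C : ℕ, ∀ (σ : Equiv.Perm (Fin k)) (m n : ℕ)
    (A : Fin m → Fin n → Bool), Function.Injective A → ¬ ContainsMkPerm σ A →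
    onesCount A ≤ C * n := by
  obtain ⟨D, hD⟩ := exists_card_family_le k (2 * k)
  refine ⟨2 * k * D + 2 * (2 * k) * (k * D), fun σ m n A hA hσ => ?_⟩
  rcases isEmpty_or_nonempty (Fin m) with _ | _
  · simp [onesCount_eq_sum]
  set s := 2 * k with hs
  have hspos : 0 < s := by omega
  set E := rowSupport A with hE
  choose ch hch hsep using fun a => exists_chunks s (E a)
  let Q : Finset (Σ _ : Fin m, ℕ) := univ.sigma fun a => range (#(E a) / s)
  let small : Finset (Fin m) := {a | 0 < #(E a) ∧ #(E a) < s}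
  have hQ : ∀ p : (Σ _ : Fin m, ℕ), p ∈ Q ↔ p.2 < #(E p.1) / s := fun p => by simp [Q]
  have hsmall : ∀ a, a ∈ small ↔ 0 < #(E a) ∧ #(E a) < s := fun a => by simp [small]
  let F : Finset (Finset ℕ) := Q.image (fun p => ch p.1 p.2) ∪ small.image E
  have hFcases : ∀ T ∈ F, ∃ a, (∃ q < #(E a) / s, T = ch a q) ∨ (a ∈ small ∧ T = E a) := by
    intro T hT
    rcases mem_union.mp hT with h | h
    · obtain ⟨p, hp, rfl⟩ := mem_image.mp h
      exact ⟨p.1, Or.inl ⟨p.2, (hQ p).mp hp, rfl⟩⟩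
    · obtain ⟨a, ha, rfl⟩ := mem_image.mp h
      exact ⟨a, Or.inr ⟨ha, rfl⟩⟩
  choose! own hown using hFcases
  have hsub : ∀ T ∈ F, T ⊆ E (own T) := by
    intro T hT
    rcases hown T hT with ⟨q, hq, h⟩ | ⟨-, h⟩
    · exact h.subset.trans (hch _ q hq).1
    · exact h.subset
  have hFcard : #F ≤ D * n := by
    have := hD σ (range n) F ?_ ?_ ?_ ?_
    · simpa using this
    · intro T hT
      rcases hown T hT with ⟨q, hq, h⟩ | ⟨ha, h⟩
      · rw [h, (hch _ q hq).2]
      · rw [h]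
        exact ((hsmall _).mp ha).2.le
    · intro T hT
      rw [← card_pos]
      rcases hown T hT with ⟨q, hq, h⟩ | ⟨ha, h⟩
      · rw [h, (hch _ q hq).2]
        exact hspos
      · rw [h]
        exact ((hsmall _).mp ha).1
    · intro T hT x hx
      exact mem_range.mpr (mem_rowSupport.mp (hsub T hT hx)).1
    · rintro ⟨w, l, r, hw, hwF, hl, hr, hlr, hmem⟩
      refine hσ (containsMkPerm_of_halves σ (a := fun i => own (w i)) ?_ hl hr hlr
        (fun i => hsub _ (hwF i) (hmem i).1) (fun i => hsub _ (hwF i) (hmem i).2))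
      intro i j hij
      have hij' : own (w i) = own (w j) := hij
      refine hw ?_
      have hi := hown _ (hwF i)
      have hj := hown _ (hwF j)
      rw [← hij'] at hj
      rcases hi with ⟨q, hq, h⟩ | ⟨ha, h⟩ <;> rcases hj with ⟨q', hq', h'⟩ | ⟨ha', h'⟩
      · rcases lt_trichotomy q q' with hlt | rfl | hlt
        · have := hsep _ q q' hlt hq' _ (h ▸ (hmem i).2) _ (h' ▸ (hmem j).1)
          exact absurd this (hlr _ _).asymm
        · rw [h, h']
        · have := hsep _ q' q hlt hq _ (h' ▸ (hmem j).2) _ (h ▸ (hmem i).1)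
          exact absurd this (hlr _ _).asymm
      · rw [Nat.div_eq_of_lt ((hsmall _).mp ha').2] at hq
        omega
      · rw [Nat.div_eq_of_lt ((hsmall _).mp ha).2] at hq'
        omega
      · rw [h, h']
  have hsmallF : #small ≤ #F := by
    rw [← card_image_of_injective small (rowSupport_injective hA)]
    exact card_le_card subset_union_right
  have hQF : #Q ≤ k * #F := by
    refine card_le_mul_card_image_of_maps_to (f := fun p : (Σ _ : Fin m, ℕ) => ch p.1 p.2)
      (fun p hp => mem_union_left _ (mem_image_of_mem _ hp)) k fun T _ => ?_
    by_contra! hlt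
    have hmem : ∀ p ∈ {p ∈ Q | ch p.1 p.2 = T}, p.2 < #(E p.1) / s ∧ ch p.1 p.2 = T :=
      fun p hp => ⟨(hQ p).mp (mem_filter.mp hp).1, (mem_filter.mp hp).2⟩
    obtain ⟨p, hp⟩ := card_pos.mp (Nat.zero_lt_of_lt hlt)
    have hTcard : #T = s := by
      rw [← (hmem p hp).2]
      exact (hch _ _ (hmem p hp).1).2
    obtain ⟨x, hx⟩ := card_pos.mp (hTcard ▸ hspos)
    refine hσ (containsMkPerm_of_subset σ (T := T)
      (R := {p ∈ Q | ch p.1 p.2 = T}.image Sigma.fst) ?_ hTcard ?_)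
    · rw [card_image_of_injOn]
      · exact hlt.le
      · rintro ⟨a, q⟩ h ⟨b, q'⟩ h' hab
        obtain rfl : a = b := hab
        obtain ⟨h1, h2⟩ := hmem _ h
        obtain ⟨h1', h2'⟩ := hmem _ h'
        rcases lt_trichotomy q q' with hqq | rfl | hqq
        · exact absurd (hsep a q q' hqq h1' x (h2 ▸ hx) x (h2' ▸ hx)) (lt_irrefl x)
        · rfl
        · exact absurd (hsep a q' q hqq h1 x (h2' ▸ hx) x (h2 ▸ hx)) (lt_irrefl x)
    · intro a ha
      obtain ⟨p', hp', rfl⟩ := mem_image.mp ha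
      rw [← (hmem p' hp').2]
      exact (hch _ _ (hmem p' hp').1).1
  have hrow : ∀ a, #(E a) ≤ s * (if a ∈ small then 1 else 0) + 2 * s * (#(E a) / s) := by
    intro a
    rcases Nat.eq_zero_or_pos #(E a) with h0 | hpos
    · rw [h0]
      exact Nat.zero_le _
    rcases lt_or_ge #(E a) s with hlt | hge
    · rw [if_pos ((hsmall a).mpr ⟨hpos, hlt⟩)]
      omega
    · have h1 : 1 ≤ #(E a) / s := (Nat.one_le_div_iff hspos).mpr hge
      have h2 := Nat.lt_mul_div_succ #(E a) hspos
      have h3 : s * 1 ≤ s * (#(E a) / s) := Nat.mul_le_mul_left _ h1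
      rw [mul_add] at h2
      rw [mul_assoc 2 s]
      omega
  calc onesCount A = ∑ a, #(E a) := onesCount_eq_sum A
    _ ≤ ∑ a, (s * (if a ∈ small then 1 else 0) + 2 * s * (#(E a) / s)) :=
      sum_le_sum fun a _ => hrow a
    _ = s * #small + 2 * s * #Q := by
      rw [sum_add_distrib, ← mul_sum, ← mul_sum, card_sigma]
      simp
    _ ≤ s * (D * n) + 2 * s * (k * (D * n)) := by
      gcongr
      · exact hsmallF.trans hFcard
      · exact hQF.trans (Nat.mul_le_mul_left _ hFcard)
    _ = _ := by ring

theorem stmt1 (k : ℕ) :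
    ∃ ck : ℕ, ∀ m n : ℕ, 1 ≤ n → ∀ A : Fin m → Fin n → Bool,
      ck * n ≤ onesCount A → Function.Injective A → ContainsMk k A := by
  rcases Nat.eq_zero_or_pos k with rfl | hk
  · exact ⟨0, fun m n _ A _ _ σ => containsMkPerm_of_subset σ (R := ∅) (T := ∅) (by simp)
      (by simp) (by simp)⟩
  obtain ⟨C, hC⟩ := exists_onesCount_le hk
  refine ⟨C + 1, fun m n hn A hcount hA σ => ?_⟩
  by_contra hσ
  have := hC σ m n A hA hσ
  rw [add_mul, one_mul] at hcount
  omega
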